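/- Let X be a nonempty set, n ≥ 3, and let F : X^n → X be associative and quasitrivial on D^n_{n-1}. Then the following are equivalent: (i) F is reducible to an associative and quasitrivial binary operation G : X^2 → X; (ii) F is reducible to an associative and idempotent binary operation G : X^2 → X; (iii) F((n-1)·x, y) = F(x, (n-1)·y) for all x, y ∈ X; (iv) F has at most one neutral element, i.e., |E_F| ≤ 1. -/

import Mathlib

variable {X : Type*}

/-- The result of substituting `F` applied to the `n` consecutive entries starting at
position `i` of the `(2n-1)`-tuple `x` (given as the first `2n-1` values of `x : ℕ → X`),
and then applying `F` to the resulting `n`-tuple. -/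
def naryCompAt (n : ℕ) (F : (Fin n → X) → X) (x : ℕ → X) (i : ℕ) : X :=
  F fun j => if (j : ℕ) < i then x j
    else if (j : ℕ) = i then F (fun k => x (i + (k : ℕ)))
    else x ((j : ℕ) + n - 1)

/-- `F` is an associative `n`-ary operation. -/
def NAryAssociative (n : ℕ) (F : (Fin n → X) → X) : Prop :=
  ∀ (x : ℕ → X) (i : ℕ), i + 1 ≤ n - 1 → naryCompAt n F x i = naryCompAt n F x (i + 1)

/-- `e` is a neutral element for the `n`-ary operation `F`: inserting the argument `a` at
any position `p`, with `e` at all the other positions, returns `a`. -/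
def NAryNeutral (n : ℕ) (F : (Fin n → X) → X) (e : X) : Prop :=
  ∀ (a : X) (p : Fin n), F (Function.update (fun _ => e) p a) = a

/-- The set `E_F` of neutral elements for `F`. -/
def naryNeutralSet (n : ℕ) (F : (Fin n → X) → X) : Set X :=
  {e | NAryNeutral n F e}

/-- `e` is a neutral element for the restriction of `F` to `S^n`. -/
def NAryNeutralOn (n : ℕ) (F : (Fin n → X) → X) (S : Set X) (e : X) : Prop :=
  e ∈ S ∧ ∀ a ∈ S, ∀ p : Fin n, F (Function.update (fun _ => e) p a) = a

/-- `iterOp G m x = G (x 0) (G (x 1) (⋯ (G (x (m-1)) (x m))⋯))`,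
the `m`-fold iterate of the binary operation `G`, applied to `m+1` arguments. -/
def iterOp (G : X → X → X) : ℕ → (ℕ → X) → X
  | 0, x => x 0
  | m + 1, x => G (x 0) (iterOp G m fun i => x (i + 1))

/-- The `n`-ary operation `F` is reducible to the binary operation `G`, i.e. `F` is the
`(n-1)`-fold iterate of `G`. -/
def NAryReducibleTo (n : ℕ) (F : (Fin n → X) → X) (G : X → X → X) : Prop :=
  ∀ x : ℕ → X, F (fun i : Fin n => x i) = iterOp G (n - 1) x

/-- `gPow G a m` is the `G`-product of `m + 1` copies of `a`. -/
def gPow (G : X → X → X) (a : X) : ℕ → X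
  | 0 => a
  | m + 1 => G a (gPow G a m)

/-- `(Y, G)` is an Abelian group whose exponent divides `m` (for `m ≥ 1`): `G` maps `Y × Y`
into `Y` and is commutative and associative on `Y`, and `Y` contains a neutral element `e`
for which every element of `Y` has an inverse and such that the `G`-product of `m` copies of
any element of `Y` equals `e`. -/
def IsAbelianGroupOfExpDvdOn (Y : Set X) (G : X → X → X) (m : ℕ) : Prop :=
  (∀ a ∈ Y, ∀ b ∈ Y, G a b ∈ Y) ∧
  (∀ a ∈ Y, ∀ b ∈ Y, G a b = G b a) ∧
  (∀ a ∈ Y, ∀ b ∈ Y, ∀ c ∈ Y, G (G a b) c = G a (G b c)) ∧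
  ∃ e ∈ Y, (∀ a ∈ Y, G e a = a) ∧ (∀ a ∈ Y, ∃ b ∈ Y, G a b = e) ∧
    (∀ a ∈ Y, gPow G a (m - 1) = e)

/-- The tuple `x` lies in `D^n_k`: at least `k` of its components are equal to each other. -/
def MemD (n k : ℕ) (x : Fin n → X) : Prop :=
  ∃ S : Finset (Fin n), k ≤ S.card ∧ ∀ i ∈ S, ∀ j ∈ S, x i = x j

/-- `F` is quasitrivial on `D^n_k`. -/
def NAryQuasitrivialOnD (n k : ℕ) (F : (Fin n → X) → X) : Prop :=
  ∀ x : Fin n → X, MemD n k x → F x ∈ Set.range x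

/-- `F` is quasitrivial on `S^n_k`, the set of tuples taking at most `k` distinct values. -/
def NAryQuasitrivialOnS (n k : ℕ) (F : (Fin n → X) → X) : Prop :=
  ∀ x : Fin n → X, (Set.range x).encard ≤ k → F x ∈ Set.range x

/-- `F` is quasitrivial. -/
def NAryQuasitrivial (n : ℕ) (F : (Fin n → X) → X) : Prop :=
  ∀ x : Fin n → X, F x ∈ Set.range x

/-- The value of a word under iterated application of the `n`-ary operation `F`, each time to
the first `n` letters; `d` is a default value for missing letters. -/
def naryEval (n : ℕ) (F : (Fin n → X) → X) (d : X) (l : List X) : X :=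
  if _ : 2 ≤ n ∧ n ≤ l.length then
    naryEval n F d (F (fun i => l.getD i d) :: l.drop n)
  else l.headD d
termination_by l.length
decreasing_by simp only [List.length_cons, List.length_drop]; omega

section Eval

variable {n : ℕ} {F : (Fin n → X) → X} {d : X}

lemma naryEval_singleton (hn : 2 ≤ n) (x : X) : naryEval n F d [x] = x := by
  rw [naryEval, dif_neg (by simp; omega)]
  rfl

lemma naryEval_append (hn : 2 ≤ n) (l v : List X) (hl : l.length = n) :
    naryEval n F d (l ++ v) = naryEval n F d (F (fun i => l.getD i d) :: v) := by
  rw [naryEval, dif_pos ⟨hn, by simp; omega⟩]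
  congr 2
  · congr 1
    funext i
    rw [List.getD_append _ _ _ _ (by omega)]
  · rw [← hl, List.drop_left]

lemma NAryAssociative.compAt_zero_eq (hF : NAryAssociative n F) (x : ℕ → X) :
    ∀ i ≤ n - 1, naryCompAt n F x 0 = naryCompAt n F x i
  | 0, _ => rfl
  | i + 1, hi => (hF.compAt_zero_eq x i (by omega)).trans (hF x i hi)

lemma NAryAssociative.apply_append (hF : NAryAssociative n F) (u xs v : List X)
    (hu : 0 < u.length) (hxs : xs.length = n) (huv : u.length + v.length + 1 = n) :
    F (fun i => (F (fun j => (u ++ xs ++ v).getD j d) :: (u ++ xs ++ v).drop n).getD i d) =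
      F (fun i => (u ++ F (fun j => xs.getD j d) :: v).getD i d) := by
  have h := hF.compAt_zero_eq (fun i => (u ++ xs ++ v).getD i d) u.length (by omega)
  unfold naryCompAt at h
  convert h using 2
  · funext i
    rcases i with ⟨_ | i, hi⟩
    · simp
    · simp only [List.getD_eq_getElem?_getD]
      simp
      congr 2
      omega
  · funext i
    rcases lt_trichotomy (i : ℕ) u.length with hi | hi | hi
    · simp only [List.getD_eq_getElem?_getD, hi, if_true]
      rw [List.getElem?_append_left (by omega), List.append_assoc,
        List.getElem?_append_left (by omega)]
    · simp only [hi, List.getD_eq_getElem?_getD, lt_irrefl, if_true, if_false]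
      rw [List.getElem?_append_right le_rfl]
      simp only [Nat.sub_self, List.getElem?_cons_zero, Option.getD_some]
      congr 1
      funext j
      rw [List.append_assoc, List.getElem?_append_right (by omega),
        List.getElem?_append_left (by omega)]
      congr 2
      omega
    · simp only [List.getD_eq_getElem?_getD, if_neg (not_lt.mpr hi.le), if_neg hi.ne']
      rw [List.getElem?_append_right hi.le, List.append_assoc,
        List.getElem?_append_right (by omega), List.getElem?_append_right (by omega),
        List.getElem?_cons, if_neg (by omega)]
      congr 2
      omega

lemma NAryAssociative.naryEval_subst (hF : NAryAssociative n F) (hn : 2 ≤ n) (xs v : List X)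
    (hxs : xs.length = n) (u : List X) (huv : (n - 1) ∣ u.length + v.length) :
    naryEval n F d (u ++ xs ++ v) = naryEval n F d (u ++ F (fun j => xs.getD j d) :: v) := by
  induction hk : u.length using Nat.strong_induction_on generalizing u with
  | _ k ih =>
  rcases Nat.eq_zero_or_pos k with rfl | hpos
  · obtain rfl := List.length_eq_zero_iff.mp hk
    exact naryEval_append hn xs v hxs
  rcases le_or_gt n k with hnk | hkn
  · obtain ⟨u₁, u₂, rfl, h₁⟩ : ∃ u₁ u₂, u = u₁ ++ u₂ ∧ u₁.length = n :=
      ⟨u.take n, u.drop n, by simp, by simp; omega⟩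
    rw [List.length_append] at huv hk
    simp only [List.append_assoc]
    rw [naryEval_append hn _ _ h₁, naryEval_append hn _ _ h₁]
    have := ih (u₂.length + 1) (by omega) (F (fun i => u₁.getD i d) :: u₂)
      (by
        rw [← Nat.dvd_add_right (dvd_refl (n - 1))]
        convert huv using 1
        simp
        omega) rfl
    simpa using this
  · have hv : n - 1 - k ≤ v.length := by
      have := Nat.le_of_dvd (by omega) huv
      omega
    obtain ⟨v₁, v₂, rfl, h₁⟩ : ∃ v₁ v₂, v = v₁ ++ v₂ ∧ v₁.length = n - 1 - k :=
      ⟨v.take (n - 1 - k), v.drop (n - 1 - k), by simp, by simp; omega⟩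
    have e₁ : u ++ xs ++ (v₁ ++ v₂) =
        (u ++ xs ++ v₁).take n ++ ((u ++ xs ++ v₁).drop n ++ v₂) := by
      rw [← List.append_assoc, ← List.append_assoc (List.take _ _), List.take_append_drop]
    have e₂ : u ++ F (fun j => xs.getD j d) :: (v₁ ++ v₂) =
        (u ++ F (fun j => xs.getD j d) :: v₁) ++ v₂ := by simp
    rw [e₁, naryEval_append hn _ _ (by simp; omega), ← List.cons_append,
      naryEval_append hn _ _ (by simp; omega), e₂, naryEval_append hn _ _ (by simp; omega),
      ← hF.apply_append u xs v₁ (by omega) hxs (by omega)]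
    congr 5
    funext i
    congr 3
    funext j
    rw [List.getD_eq_getElem?_getD, List.getD_eq_getElem?_getD, List.getElem?_take_of_lt j.2]

end Eval

open Classical in
/-- The syntactic congruence, on words, of the partial operation `naryEval`, which is only
meaningful on words whose length is congruent to `1` modulo `n - 1`. -/
noncomputable def naryCon (n : ℕ) (F : (Fin n → X) → X) (d : X) : Con (FreeMonoid X) :=
  let Q : FreeMonoid X → Option X := fun w =>
    if w.length ≡ 1 [MOD n - 1] then some (naryEval n F d w.toList) else none
  { r := fun w w' => ∀ u v, Q (u * w * v) = Q (u * w' * v)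
    iseqv := ⟨fun _ _ _ => rfl, fun h u v => (h u v).symm,
      fun h h' u v => (h u v).trans (h' u v)⟩
    mul' := by
      intro w x y z h h' u v
      have h₁ := h u (y * v)
      have h₂ := h' (u * x) v
      simp only [mul_assoc] at h₁ h₂ ⊢
      exact h₁.trans h₂ }

/-- Every associative `n`-ary operation is, up to an injection, the restriction of the `n`-fold
product of a monoid. -/
theorem NAryAssociative.exists_monoid_embedding {X : Type*} [Nonempty X] {n : ℕ} (hn : 2 ≤ n)
    {F : (Fin n → X) → X} (hF : NAryAssociative n F) :
    ∃ (c : Con (FreeMonoid X)) (ι : X → c.Quotient), Function.Injective ι ∧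
      ∀ x, ι (F x) = (List.ofFn fun i => ι (x i)).prod := by
  classical
  obtain ⟨d⟩ := ‹Nonempty X›
  refine ⟨naryCon n F d, fun x => (naryCon n F d).mk' (FreeMonoid.of x), ?_, ?_⟩
  · intro x y h
    have h' := (Con.eq _).mp h 1 1
    simp only [one_mul, mul_one, FreeMonoid.length_of, Nat.ModEq.refl, if_true,
      FreeMonoid.toList_of, naryEval_singleton hn, Option.some.injEq] at h'
    exact h'
  · intro x
    have hprod : (List.ofFn fun i => (naryCon n F d).mk' (FreeMonoid.of (x i))).prod =
        (naryCon n F d).mk' (FreeMonoid.ofList (List.ofFn x)) := by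
      generalize hl : List.ofFn x = l
      have : (List.ofFn fun i => (naryCon n F d).mk' (FreeMonoid.of (x i))) =
          l.map fun a => (naryCon n F d).mk' (FreeMonoid.of a) := by
        rw [← hl, List.map_ofFn]; rfl
      rw [this]
      clear hl this
      induction l with
      | nil => simp
      | cons a l ih => rw [List.map_cons, List.prod_cons, ih, FreeMonoid.ofList_cons, map_mul]
    rw [hprod]
    refine ((Con.eq _).mpr fun u v => ?_).symm
    have hlen : (u * FreeMonoid.ofList (List.ofFn x) * v).length =
        (n - 1) + (u * FreeMonoid.of (F x) * v).length := by
      simp only [FreeMonoid.length_mul, FreeMonoid.length_of]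
      have : (FreeMonoid.ofList (List.ofFn x)).length = n := List.length_ofFn
      omega
    have hiff : (u * FreeMonoid.ofList (List.ofFn x) * v).length ≡ 1 [MOD n - 1] ↔
        (u * FreeMonoid.of (F x) * v).length ≡ 1 [MOD n - 1] := by
      rw [hlen, Nat.ModEq, Nat.ModEq, Nat.add_mod_left]
    simp only [hiff]
    split_ifs with h
    · have hdvd : n - 1 ∣ u.toList.length + v.toList.length := by
        have h' := (Nat.modEq_iff_dvd' (by simp [FreeMonoid.length_mul]; omega)).mp h.symm
        convert h' using 1
        simp only [FreeMonoid.length_mul, FreeMonoid.length_of]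
        change u.length + v.length = _
        omega
      have := hF.naryEval_subst (d := d) hn (List.ofFn x) v.toList (by simp) u.toList hdvd
      simp only [FreeMonoid.toList_mul, FreeMonoid.toList_of, FreeMonoid.toList_ofList, this]
      simp
    · rfl

lemma List.prod_ofFn_update_const {M : Type*} [Monoid M] {X : Type*} (ι : X → M) (n : ℕ)
    (a b : X) (p : Fin n) :
    (List.ofFn fun i => ι (Function.update (fun _ => a) p b i)).prod =
      ι a ^ (p : ℕ) * ι b * ι a ^ (n - 1 - p) := by
  have : (List.ofFn fun i => ι (Function.update (fun _ => a) p b i)) =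
      List.replicate p (ι a) ++ ι b :: List.replicate (n - 1 - p) (ι a) := by
    apply List.ext_getElem
    · simp; omega
    · intro i h₁ h₂
      simp only [List.getElem_ofFn, Function.update_apply, Fin.ext_iff]
      grind
  rw [this]
  simp [mul_assoc]

lemma NAryQuasitrivialOnD.update_eq_or {n : ℕ} {F : (Fin n → X) → X}
    (hQ : NAryQuasitrivialOnD n (n - 1) F) (a b : X) (p : Fin n) :
    F (Function.update (fun _ => a) p b) = a ∨ F (Function.update (fun _ => a) p b) = b := by
  obtain ⟨i, hi⟩ := hQ (Function.update (fun _ => a) p b)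
    ⟨Finset.univ.erase p, by simp [Finset.card_erase_of_mem], by
      intro i hi j hj
      simp only [Finset.mem_erase] at hi hj
      rw [Function.update_of_ne hi.1, Function.update_of_ne hj.1]⟩
  rw [← hi, Function.update_apply]
  split_ifs <;> simp

section Iterate

variable {M : Type*} [Monoid M] {N : ℕ} {ι : X → M} {G : X → X → X}

lemma mul_pow_add_eq_pow_succ_mul (hpow : ∀ a, ι a ^ (N + 1) = ι a)
    (hcomm : ∀ a b, ι a ^ N * ι b = ι a * ι b ^ N) (a b : X) (k : ℕ) :
    ι a * ι b ^ (k + N) = ι a ^ (k + 1) * ι b ^ N := by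
  induction k with
  | zero => simp
  | succ k ih =>
    calc ι a * ι b ^ (k + 1 + N) = ι a * ι b ^ (k + N) * ι b := by
          rw [mul_assoc, ← pow_succ]; congr 2; omega
      _ = ι a ^ (k + 1) * ι b := by rw [ih, mul_assoc, ← pow_succ, hpow]
      _ = ι a ^ k * ι a ^ (N + 1) * ι b := by rw [hpow, pow_succ]
      _ = ι a ^ (k + 1) * (ι a ^ N * ι b) := by
          rw [← mul_assoc, ← pow_add, ← pow_add]; congr 2; omega
      _ = ι a ^ (k + 1 + 1) * ι b ^ N := by rw [hcomm, ← mul_assoc, ← pow_succ]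

lemma pow_mul_iterOp (hpow : ∀ a, ι a ^ (N + 1) = ι a)
    (hG : ∀ a b, ι (G a b) = ι a ^ N * ι b) (m : ℕ) (x : ℕ → X) :
    ι (x 0) ^ N * ι (iterOp G m x) = ι (iterOp G m x) := by
  cases m with
  | zero => rw [iterOp, ← pow_succ, hpow]
  | succ m =>
    rcases N with _ | N
    · simp
    · rw [iterOp, hG, ← mul_assoc, ← pow_add,
        show N + 1 + (N + 1) = N + (N + 1 + 1) by omega, pow_add, hpow, pow_succ]

lemma prod_ofFn_eq_pow_mul_iterOp (hpow : ∀ a, ι a ^ (N + 1) = ι a)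
    (hcomm : ∀ a b, ι a ^ N * ι b = ι a * ι b ^ N)
    (hG : ∀ a b, ι (G a b) = ι a ^ N * ι b) (m : ℕ) (x : ℕ → X) :
    (List.ofFn fun i : Fin (m + 1) => ι (x i)).prod = ι (x 0) ^ m * ι (iterOp G m x) := by
  induction m generalizing x with
  | zero => simp [iterOp]
  | succ m ih =>
    have h := pow_mul_iterOp hpow hG m fun i => x (i + 1)
    have ih' := ih fun i => x (i + 1)
    rw [List.ofFn_succ, List.prod_cons]
    simp only [Fin.val_succ, Fin.val_zero]
    rw [ih', iterOp, hG, ← h, zero_add, ← mul_assoc (_ ^ m), ← pow_add, ← mul_assoc,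
      mul_pow_add_eq_pow_succ_mul hpow hcomm, mul_assoc, h, ← mul_assoc, ← pow_add,
      show m + 1 + N = m + (N + 1) by omega, pow_add _ m (N + 1), hpow,
      ← pow_succ]

end Iterate

lemma iterOp_const {G : X → X → X} (hG : ∀ a, G a a = a) (a : X) (m : ℕ) :
    iterOp G m (fun _ => a) = a := by
  induction m with
  | zero => rfl
  | succ m ih => rw [iterOp, ih, hG]

lemma iterOp_update_last {G : X → X → X} (hA : ∀ a b c, G (G a b) c = G a (G b c))
    (hG : ∀ a, G a a = a) (a b : X) (m : ℕ) :
    iterOp G (m + 1) (Function.update (fun _ => a) (m + 1) b) = G a b := by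
  induction m with
  | zero => simp [iterOp]
  | succ m ih =>
    have : (fun i => Function.update (fun _ => a) (m + 1 + 1) b (i + 1)) =
        Function.update (fun _ => a) (m + 1) b := by
      funext i
      simp [Function.update_apply]
    rw [iterOp, this, ih, Function.update_of_ne (by omega), ← hA, hG]

lemma iterOp_update_zero {G : X → X → X} (hG : ∀ a, G a a = a) (a b : X) (m : ℕ) :
    iterOp G (m + 1) (Function.update (fun _ => b) 0 a) = G a b := by
  have : (fun i => Function.update (fun _ => b) 0 a (i + 1)) = fun _ => b := by
    funext i
    simp
  rw [iterOp, this, iterOp_const hG, Function.update_self]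

/-- If `F` is represented by products in a monoid and is quasitrivial on `D^n_{n-1}`, then two
distinct elements having the same `(n-1)`-st power in the monoid are neutral. -/
lemma neutral_of_pow_eq {n : ℕ} {F : (Fin n → X) → X} {M : Type*} [Monoid M]
    {ι : X → M} (hι : Function.Injective ι)
    (hF : ∀ a b (p : Fin n), ι (F (Function.update (fun _ => a) p b)) =
      ι a ^ (p : ℕ) * ι b * ι a ^ (n - 1 - p))
    (hQ : ∀ a b (p : Fin n), F (Function.update (fun _ => a) p b) = a ∨
      F (Function.update (fun _ => a) p b) = b)
    {a b : X} (hab : a ≠ b) (h : ι a ^ (n - 1) = ι b ^ (n - 1)) : NAryNeutral n F a := by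
  intro x p
  have hn : 0 < n := p.pos
  have hl : ι a ^ (n - 1) * ι x = ι x := by
    have h₁ := hF a x ⟨n - 1, by omega⟩
    have h₂ := hF b x ⟨n - 1, by omega⟩
    have q₁ := hQ a x ⟨n - 1, by omega⟩
    have q₂ := hQ b x ⟨n - 1, by omega⟩
    simp only [Nat.sub_self, pow_zero, mul_one, ← h] at h₁ h₂
    have := hι (h₁.trans h₂.symm)
    rw [← h₁]
    grind
  have hr : ι x * ι a ^ (n - 1) = ι x := by
    have h₁ := hF a x ⟨0, by omega⟩
    have h₂ := hF b x ⟨0, by omega⟩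
    have q₁ := hQ a x ⟨0, by omega⟩
    have q₂ := hQ b x ⟨0, by omega⟩
    simp only [Nat.sub_zero, pow_zero, one_mul, ← h] at h₁ h₂
    have := hι (h₁.trans h₂.symm)
    rw [← h₁]
    grind
  have ha : ι a ^ (n - 1) * ι a = ι a := by
    have h₁ := hF a a ⟨n - 1, by omega⟩
    have q₁ := hQ a a ⟨n - 1, by omega⟩
    simp only [Nat.sub_self, pow_zero, mul_one] at h₁
    rw [← h₁, q₁.elim id id]
  rcases hQ a x p with hx | hx
  · have h₁ := hF a x p
    rw [hx] at h₁ ⊢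
    apply hι
    calc ι a = ι a ^ (n - 1 - p) * ι a * ι a ^ (p : ℕ) := by
          rw [← pow_succ, ← pow_add, show n - 1 - p + 1 + (p : ℕ) = n - 1 + 1 by omega, pow_succ,
            ha]
      _ = ι a ^ (n - 1 - p) * (ι a ^ (p : ℕ) * ι x * ι a ^ (n - 1 - p)) * ι a ^ (p : ℕ) := by
          rw [← h₁]
      _ = ι a ^ (n - 1 - p + p) * ι x * ι a ^ (n - 1 - p + p) := by
          simp only [pow_add, mul_assoc]
      _ = ι x := by rw [show n - 1 - p + (p : ℕ) = n - 1 by omega, hl, hr]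
  · exact hx

/-- In a monoid, if `a ^ N * b` and `a * b ^ N` are distinct members of `{a, b}` and
`a ^ (N + 1) = a`, then `a` and `b` have the same `N`-th power. -/
lemma pow_eq_pow_of_pow_mul_ne {M : Type*} [Monoid M] {N : ℕ} (hN : 0 < N) {a b : M}
    (ha : a ^ (N + 1) = a) (h₁ : a ^ N * b = a ∨ a ^ N * b = b)
    (h₂ : a * b ^ N = a ∨ a * b ^ N = b) (hne : a ^ N * b ≠ a * b ^ N) : a ^ N = b ^ N := by
  obtain ⟨k, rfl⟩ : ∃ k, N = k + 1 := ⟨N - 1, by omega⟩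
  have hB : a ^ (k + 1) * b ≠ a := by
    intro h
    have hab : a * b = a * a := by
      calc a * b = a ^ (k + 1 + 1) * b := by rw [ha]
        _ = a * a := by rw [pow_succ' a (k + 1), mul_assoc, h]
    have hpow : ∀ j, a * b ^ j = a ^ (j + 1) := by
      intro j
      induction j with
      | zero => simp
      | succ j ih => rw [pow_succ, ← mul_assoc, ih, pow_succ, mul_assoc, hab, ← mul_assoc,
          ← pow_succ, ← pow_succ]
    exact hne (by rw [h, hpow, ha])
  have hb' := h₁.resolve_left hB
  have ha' : a * b ^ (k + 1) = a := h₂.resolve_right fun h => hne (hb'.trans h.symm)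
  calc a ^ (k + 1) = a ^ k * (a * b ^ (k + 1)) := by rw [ha', pow_succ]
    _ = a ^ (k + 1) * b * b ^ k := by rw [pow_succ' b, pow_succ a]; simp only [mul_assoc]
    _ = b ^ (k + 1) := by rw [hb', pow_succ']

/-- For `F` associative and quasitrivial on `D^n_{n-1}`, the following are equivalent:
(i) `F` is reducible to an associative quasitrivial binary operation;
(ii) `F` is reducible to an associative idempotent binary operation;
(iii) `F ((n-1)·x, y) = F (x, (n-1)·y)` for all `x, y`;
(iv) `F` has at most one neutral element. -/
theorem stmt_19 {X : Type*} [Nonempty X] (n : ℕ) (hn : 3 ≤ n)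
    (F : (Fin n → X) → X) (hF : NAryAssociative n F)
    (hQ : NAryQuasitrivialOnD n (n - 1) F) :
    ((∃ G : X → X → X, (∀ a b c, G (G a b) c = G a (G b c)) ∧
        (∀ a b, G a b = a ∨ G a b = b) ∧ NAryReducibleTo n F G) ↔
      (∃ G : X → X → X, (∀ a b c, G (G a b) c = G a (G b c)) ∧
        (∀ a, G a a = a) ∧ NAryReducibleTo n F G)) ∧
    ((∃ G : X → X → X, (∀ a b c, G (G a b) c = G a (G b c)) ∧
        (∀ a, G a a = a) ∧ NAryReducibleTo n F G) ↔
      (∀ a b : X,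
        F (Function.update (fun _ => a) (⟨n - 1, by omega⟩ : Fin n) b) =
        F (Function.update (fun _ => b) (⟨0, by omega⟩ : Fin n) a))) ∧
    ((∀ a b : X,
        F (Function.update (fun _ => a) (⟨n - 1, by omega⟩ : Fin n) b) =
        F (Function.update (fun _ => b) (⟨0, by omega⟩ : Fin n) a)) ↔
      (naryNeutralSet n F).encard ≤ 1) := by
  obtain ⟨c, ι, hι, hprod⟩ := hF.exists_monoid_embedding (by omega)
  have hupd : ∀ a b (p : Fin n), ι (F (Function.update (fun _ => a) p b)) =
      ι a ^ (p : ℕ) * ι b * ι a ^ (n - 1 - p) := fun a b p => by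
    rw [hprod, List.prod_ofFn_update_const]
  have hQ' := hQ.update_eq_or
  obtain ⟨N, rfl⟩ : ∃ N, n = N + 1 := ⟨n - 1, by omega⟩
  have hl : ∀ a b, ι (F (Function.update (fun _ => a) ⟨N + 1 - 1, by omega⟩ b)) =
      ι a ^ N * ι b := fun a b => by simp [hupd]
  have hr : ∀ a b, ι (F (Function.update (fun _ => b) ⟨0, by omega⟩ a)) =
      ι a * ι b ^ N := fun a b => by simp [hupd]
  have hpow : ∀ a, ι a ^ (N + 1) = ι a := fun a => by
    rw [pow_succ, ← hl, (hQ' _ _ _).elim id id]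
  have h₁₂ : (∃ G : X → X → X, (∀ a b c, G (G a b) c = G a (G b c)) ∧
      (∀ a b, G a b = a ∨ G a b = b) ∧ NAryReducibleTo (N + 1) F G) →
      (∃ G : X → X → X, (∀ a b c, G (G a b) c = G a (G b c)) ∧
        (∀ a, G a a = a) ∧ NAryReducibleTo (N + 1) F G) :=
    fun ⟨G, hA, hG, hR⟩ => ⟨G, hA, fun a => (hG a a).elim id id, hR⟩
  have h₂₃ : (∃ G : X → X → X, (∀ a b c, G (G a b) c = G a (G b c)) ∧
      (∀ a, G a a = a) ∧ NAryReducibleTo (N + 1) F G) → ∀ a b : X,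
        F (Function.update (fun _ => a) (⟨N + 1 - 1, by omega⟩ : Fin (N + 1)) b) =
        F (Function.update (fun _ => b) (⟨0, by omega⟩ : Fin (N + 1)) a) := by
    rintro ⟨G, hA, hG, hR⟩ a b
    obtain ⟨m, rfl⟩ : ∃ m, N = m + 1 := ⟨N - 1, by omega⟩
    have h₁ := hR (Function.update (fun _ => a) (m + 1) b)
    have h₂ := hR (Function.update (fun _ => b) 0 a)
    rw [Nat.add_sub_cancel, iterOp_update_last hA hG] at h₁
    rw [Nat.add_sub_cancel, iterOp_update_zero hG, ← h₁] at h₂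
    convert h₂.symm using 2 <;> funext i <;>
      simp only [Function.update_apply, Fin.ext_iff, Nat.add_sub_cancel]
  have h₃₁ : (∀ a b : X,
        F (Function.update (fun _ => a) (⟨N + 1 - 1, by omega⟩ : Fin (N + 1)) b) =
        F (Function.update (fun _ => b) (⟨0, by omega⟩ : Fin (N + 1)) a)) →
      ∃ G : X → X → X, (∀ a b c, G (G a b) c = G a (G b c)) ∧
        (∀ a b, G a b = a ∨ G a b = b) ∧ NAryReducibleTo (N + 1) F G := by
    intro h
    have hcomm : ∀ a b, ι a ^ N * ι b = ι a * ι b ^ N := fun a b => by rw [← hl, ← hr, h]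
    refine ⟨fun a b => F (Function.update (fun _ => a) ⟨N + 1 - 1, by omega⟩ b), ?_,
      fun a b => hQ' a b _, fun x => hι ?_⟩
    · intro a b c
      apply hι
      rw [hl, hcomm, hl, hl, hl, mul_assoc, hcomm b c]
    · rw [hprod, prod_ofFn_eq_pow_mul_iterOp hpow hcomm hl, pow_mul_iterOp hpow hl]
      rfl
  refine ⟨⟨h₁₂, fun h => h₃₁ (h₂₃ h)⟩, ⟨h₂₃, fun h => h₁₂ (h₃₁ h)⟩, fun h => ?_, fun h a b => ?_⟩
  · rw [Set.encard_le_one_iff]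
    intro e f he hf
    rw [← hf e ⟨0, by omega⟩, ← h, he]
  · by_contra hne
    have hab : a ≠ b := by
      rintro rfl
      exact hne ((hQ' _ _ _).elim id id |>.trans ((hQ' _ _ _).elim id id).symm)
    have heq : ι a ^ N = ι b ^ N := by
      apply pow_eq_pow_of_pow_mul_ne (by omega) (hpow a)
      · rw [← hl]
        exact (hQ' a b _).imp (congrArg ι) (congrArg ι)
      · rw [← hr]
        exact (hQ' b a _).symm.imp (congrArg ι) (congrArg ι)
      · rw [← hl, ← hr]
        exact fun h => hne (hι h)
    exact hab (Set.encard_le_one_iff.mp h a b (neutral_of_pow_eq hι hupd hQ' hab heq)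
      (neutral_of_pow_eq hι hupd hQ' hab.symm heq.symm))
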